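/- For every fixed t > 0 and x ∈ ℝ³ there exist constants c₁, c₂ > 0 and an integer N ≥ 1 such that for all n ≥ N, one has c₁ · 2^{n/2} ≤ c_n(t,x) ≤ c₂ · 2^{n/2}, where c_n = 3·c¹_n − 9·c²_n is the renormalization function. -/

import Mathlib

open MeasureTheory Real

noncomputable section

/-- Mehler heat kernel of the harmonic oscillator `H = -Δ + |x|²` on `ℝ³`. -/
def mehlerK (t : ℝ) (x y : EuclideanSpace ℝ (Fin 3)) : ℝ :=
  (2 * π * Real.sinh (2 * t)) ^ (-(3 : ℝ) / 2) *
    Real.exp (-‖x - y‖ ^ 2 / (4 * Real.tanh t) - Real.tanh t * ‖x + y‖ ^ 2 / 4)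

/-- The regularized covariance `𝒞⁽ⁿ⁾_{t₁,t₂}(y₁,y₂)`, with `ε_n = 2^{-n}`. -/
def covC (n : ℕ) (t₁ t₂ : ℝ) (y₁ y₂ : EuclideanSpace ℝ (Fin 3)) : ℝ :=
  (1 / 2) * ∫ σ in (|t₂ - t₁| + 2 * (2 : ℝ) ^ (-(n : ℝ)))..(t₁ + t₂ + 2 * (2 : ℝ) ^ (-(n : ℝ))),
    mehlerK σ y₁ y₂

/-- First renormalization function `c¹_n(t,x) = ∫_{2^{-n}}^{t+2^{-n}} K_{2σ}(x,x) dσ`. -/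
def c1 (n : ℕ) (t : ℝ) (x : EuclideanSpace ℝ (Fin 3)) : ℝ :=
  ∫ σ in ((2 : ℝ) ^ (-(n : ℝ)))..(t + (2 : ℝ) ^ (-(n : ℝ))), mehlerK (2 * σ) x x

/-- Second renormalization function
`c²_n(t,x) = 2 ∫₀^t ∫ K_{t-s}(x,w) 𝒞⁽ⁿ⁾_{t,s}(x,w)² dw ds`. -/
def c2 (n : ℕ) (t : ℝ) (x : EuclideanSpace ℝ (Fin 3)) : ℝ :=
  2 * ∫ s in (0 : ℝ)..t, ∫ w, mehlerK (t - s) x w * covC n t s x w ^ 2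

/-- The renormalization function `c_n = 3 c¹_n - 9 c²_n`. -/
def cRen (n : ℕ) (t : ℝ) (x : EuclideanSpace ℝ (Fin 3)) : ℝ :=
  3 * c1 n t x - 9 * c2 n t x

lemma mehlerK_nonneg {t : ℝ} (ht : 0 ≤ t) (x y : EuclideanSpace ℝ (Fin 3)) :
    0 ≤ mehlerK t x y := by
  have : 0 ≤ Real.sinh (2 * t) := Real.sinh_nonneg_iff.2 (by linarith)
  unfold mehlerK
  positivity

lemma tanh_pos_of_pos {t : ℝ} (ht : 0 < t) : 0 < Real.tanh t := by
  rw [Real.tanh_eq_sinh_div_cosh]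
  exact div_pos (Real.sinh_pos_iff.2 ht) (Real.cosh_pos t)

lemma continuousOn_mehlerK (x y : EuclideanSpace ℝ (Fin 3)) :
    ContinuousOn (fun t => mehlerK t x y) (Set.Ioi 0) := by
  have hs : ContinuousOn (fun t : ℝ => 2 * π * Real.sinh (2 * t)) (Set.Ioi 0) :=
    (continuous_const.mul (Real.continuous_sinh.comp (by fun_prop))).continuousOn
  have ht : Continuous Real.tanh := by
    rw [funext Real.tanh_eq_sinh_div_cosh]
    exact Real.continuous_sinh.div Real.continuous_cosh fun t => (Real.cosh_pos t).ne'
  unfold mehlerK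
  refine (hs.rpow_const fun t h => Or.inl ?_).mul (Real.continuous_exp.comp_continuousOn
    (((continuousOn_const).div (continuous_const.mul ht).continuousOn fun t h => ?_).sub
      (by fun_prop)))
  · have : 0 < Real.sinh (2 * t) := Real.sinh_pos_iff.2 (mul_pos two_pos h)
    positivity
  · exact (mul_pos four_pos (tanh_pos_of_pos h)).ne'

lemma intervalIntegrable_mehlerK (x y : EuclideanSpace ℝ (Fin 3)) {a b : ℝ} (ha : 0 < a)
    (hab : a ≤ b) : IntervalIntegrable (fun t => mehlerK t x y) volume a b :=
  ((continuousOn_mehlerK x y).mono fun _ h => lt_of_lt_of_le ha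
    (by rw [Set.uIcc_of_le hab] at h; exact h.1)).intervalIntegrable

lemma mehlerK_le_rpow {t : ℝ} (ht : 0 < t) (x y : EuclideanSpace ℝ (Fin 3)) :
    mehlerK t x y ≤ t ^ (-(3 : ℝ) / 2) := by
  have h1 : t ≤ 2 * π * Real.sinh (2 * t) := by
    have := Real.self_le_sinh_iff.2 (by linarith : 0 ≤ 2 * t)
    nlinarith [Real.pi_gt_three]
  have h2 : -‖x - y‖ ^ 2 / (4 * Real.tanh t) - Real.tanh t * ‖x + y‖ ^ 2 / 4 ≤ 0 := by
    have := tanh_pos_of_pos ht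
    have h3 : 0 ≤ ‖x - y‖ ^ 2 / (4 * Real.tanh t) := by positivity
    have h4 : 0 ≤ Real.tanh t * ‖x + y‖ ^ 2 / 4 := by positivity
    rw [neg_div]
    linarith
  calc mehlerK t x y ≤ t ^ (-(3 : ℝ) / 2) * 1 :=
        mul_le_mul (Real.rpow_le_rpow_of_nonpos ht h1 (by norm_num)) (Real.exp_le_one_iff.2 h2)
          (Real.exp_pos _).le (by positivity)
    _ = _ := mul_one _

lemma intervalIntegrable_rpow_neg_three_halves {a b : ℝ} (ha : 0 < a) (hab : a ≤ b) :
    IntervalIntegrable (fun x : ℝ => x ^ (-(3 : ℝ) / 2)) volume a b := by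
  refine intervalIntegral.intervalIntegrable_rpow (Or.inr fun h => ?_)
  rw [Set.uIcc_of_le hab] at h
  exact absurd h.1 (not_le.2 ha)

lemma integral_rpow_neg_three_halves_le {a b : ℝ} (ha : 0 < a) (hab : a ≤ b) :
    ∫ x in a..b, x ^ (-(3 : ℝ) / 2) ≤ 2 * a ^ (-(1 : ℝ) / 2) := by
  rw [integral_rpow (Or.inr ⟨by norm_num, fun h => ?_⟩)]
  · have h0 : 0 ≤ b ^ (-(1 : ℝ) / 2) := Real.rpow_nonneg (by linarith) _
    norm_num at h0 ⊢
    linarith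
  · rw [Set.uIcc_of_le hab] at h
    exact absurd h.1 (not_le.2 ha)

lemma integral_mehlerK_le (x y : EuclideanSpace ℝ (Fin 3)) {a b : ℝ} (ha : 0 < a)
    (hab : a ≤ b) : ∫ σ in a..b, mehlerK σ x y ≤ 2 * a ^ (-(1 : ℝ) / 2) :=
  (intervalIntegral.integral_mono_on hab (intervalIntegrable_mehlerK x y ha hab)
    (intervalIntegrable_rpow_neg_three_halves ha hab) fun _ h =>
      mehlerK_le_rpow (ha.trans_le h.1) x y).trans (integral_rpow_neg_three_halves_le ha hab)

lemma integral_exp_neg_mul_dist_sq {b : ℝ} (hb : 0 < b) (x : EuclideanSpace ℝ (Fin 3)) :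
    Integrable (fun w => Real.exp (-b * ‖x - w‖ ^ 2)) ∧
      ∫ w, Real.exp (-b * ‖x - w‖ ^ 2) = (π / b) ^ ((3 : ℝ) / 2) := by
  have h : ∫ w, Real.exp (-b * ‖x - w‖ ^ 2) = (π / b) ^ ((3 : ℝ) / 2) := by
    rw [integral_sub_left_eq_self (fun w => Real.exp (-b * ‖w‖ ^ 2)) volume x,
      GaussianFourier.integral_rexp_neg_mul_sq_norm hb]
    simp
  refine ⟨by_contra fun hn => ?_, h⟩
  rw [integral_undef hn] at h
  have : 0 < (π / b) ^ ((3 : ℝ) / 2) := by positivity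
  linarith

/-- The Mehler kernel is dominated by an integrable Gaussian of total mass at most one. -/
lemma exists_integrable_mehlerK_le {t : ℝ} (ht : 0 < t) (x : EuclideanSpace ℝ (Fin 3)) :
    ∃ g : EuclideanSpace ℝ (Fin 3) → ℝ, Integrable g ∧ (∀ w, mehlerK t x w ≤ g w) ∧
      ∫ w, g w ≤ 1 := by
  have hT := tanh_pos_of_pos ht
  have hs : 0 < Real.sinh (2 * t) := Real.sinh_pos_iff.2 (by linarith)
  have hb : 0 < 1 / (4 * Real.tanh t) := by positivity
  obtain ⟨hi, he⟩ := integral_exp_neg_mul_dist_sq hb x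
  have hle : π / (1 / (4 * Real.tanh t)) ≤ 2 * π * Real.sinh (2 * t) := by
    have hc := Real.one_le_cosh t
    have hst : 0 < Real.sinh t := Real.sinh_pos_iff.2 ht
    have h1 : Real.tanh t ≤ Real.sinh t * Real.cosh t := by
      rw [Real.tanh_eq_sinh_div_cosh]
      calc Real.sinh t / Real.cosh t ≤ Real.sinh t := div_le_self hst.le hc
        _ ≤ _ := le_mul_of_one_le_right hst.le hc
    rw [Real.sinh_two_mul, div_div_eq_mul_div, div_one]
    nlinarith [Real.pi_pos]
  refine ⟨fun w => (2 * π * Real.sinh (2 * t)) ^ (-(3 : ℝ) / 2) *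
    Real.exp (-(1 / (4 * Real.tanh t)) * ‖x - w‖ ^ 2), hi.const_mul _, fun w => ?_, ?_⟩
  · refine mul_le_mul_of_nonneg_left (Real.exp_le_exp.2 ?_) (by positivity)
    have : 0 ≤ Real.tanh t * ‖x + w‖ ^ 2 / 4 := by positivity
    have h2 : -‖x - w‖ ^ 2 / (4 * Real.tanh t) = -(1 / (4 * Real.tanh t)) * ‖x - w‖ ^ 2 := by
      ring
    linarith
  · rw [integral_const_mul, he]
    calc _ ≤ (2 * π * Real.sinh (2 * t)) ^ (-(3 : ℝ) / 2) *
          (2 * π * Real.sinh (2 * t)) ^ ((3 : ℝ) / 2) := by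
            gcongr
      _ = 1 := by
        rw [← Real.rpow_add (by positivity)]
        norm_num

lemma covC_sq_le (n : ℕ) {t s : ℝ} (hs : 0 ≤ s) (hst : s ≤ t)
    (x w : EuclideanSpace ℝ (Fin 3)) :
    covC n t s x w ^ 2 ≤ (t - s + 2 * (2 : ℝ) ^ (-(n : ℝ)))⁻¹ := by
  have he : (0 : ℝ) < 2 ^ (-(n : ℝ)) := by positivity
  have habs : |s - t| = t - s := by rw [abs_sub_comm, abs_of_nonneg (by linarith)]
  unfold covC
  rw [habs]
  set e : ℝ := 2 ^ (-(n : ℝ))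
  have ha : 0 < t - s + 2 * e := by linarith
  have hab : t - s + 2 * e ≤ t + s + 2 * e := by linarith
  have h0 : 0 ≤ ∫ σ in (t - s + 2 * e)..(t + s + 2 * e), mehlerK σ x w :=
    intervalIntegral.integral_nonneg hab fun σ h => mehlerK_nonneg (ha.le.trans h.1) x w
  have h1 := integral_mehlerK_le x w ha hab
  calc _ ≤ ((t - s + 2 * e) ^ (-(1 : ℝ) / 2)) ^ 2 :=
        pow_le_pow_left₀ (by linarith) (by linarith) 2
    _ = _ := by
      rw [← Real.rpow_natCast, ← Real.rpow_mul ha.le, ← Real.rpow_neg_one]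
      norm_num

lemma integral_mehlerK_mul_covC_sq_le (n : ℕ) {t s : ℝ} (hs : 0 ≤ s) (hst : s < t)
    (x : EuclideanSpace ℝ (Fin 3)) :
    ∫ w, mehlerK (t - s) x w * covC n t s x w ^ 2 ≤
      (t - s + 2 * (2 : ℝ) ^ (-(n : ℝ)))⁻¹ := by
  obtain ⟨g, hgi, hg, hg1⟩ := exists_integrable_mehlerK_le (sub_pos.2 hst) x
  have hK := fun w => mehlerK_nonneg (sub_pos.2 hst).le x w
  have hr : 0 ≤ (t - s + 2 * (2 : ℝ) ^ (-(n : ℝ)))⁻¹ :=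
    (sq_nonneg _).trans (covC_sq_le n hs hst.le x x)
  calc _ ≤ ∫ w, g w * (t - s + 2 * (2 : ℝ) ^ (-(n : ℝ)))⁻¹ := by
        refine integral_mono_of_nonneg (.of_forall fun w => mul_nonneg (hK w) (sq_nonneg _))
          (hgi.mul_const _) (.of_forall fun w => ?_)
        exact mul_le_mul (hg w) (covC_sq_le n hs hst.le x w) (sq_nonneg _) ((hK w).trans (hg w))
    _ ≤ _ := by
      rw [integral_mul_const]
      exact mul_le_of_le_one_left hr hg1

lemma c2_nonneg (n : ℕ) {t : ℝ} (ht : 0 ≤ t) (x : EuclideanSpace ℝ (Fin 3)) :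
    0 ≤ c2 n t x :=
  mul_nonneg two_pos.le (intervalIntegral.integral_nonneg ht fun _ hs =>
    integral_nonneg fun w => mul_nonneg (mehlerK_nonneg (sub_nonneg.2 hs.2) x w) (sq_nonneg _))

/-- The second renormalization function diverges at most logarithmically. -/
lemma c2_le_log (n : ℕ) {t : ℝ} (ht : 0 < t) (x : EuclideanSpace ℝ (Fin 3)) :
    c2 n t x ≤ 2 * Real.log ((t + 2 * (2 : ℝ) ^ (-(n : ℝ))) / (2 * (2 : ℝ) ^ (-(n : ℝ)))) := by
  have he : (0 : ℝ) < 2 * 2 ^ (-(n : ℝ)) := by positivity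
  have hcomp : ∫ s in (0 : ℝ)..t, (t - s + 2 * (2 : ℝ) ^ (-(n : ℝ)))⁻¹ =
      Real.log ((t + 2 * (2 : ℝ) ^ (-(n : ℝ))) / (2 * (2 : ℝ) ^ (-(n : ℝ)))) := by
    rw [intervalIntegral.integral_comp_sub_left
      (fun s => (s + 2 * (2 : ℝ) ^ (-(n : ℝ)))⁻¹) t, intervalIntegral.integral_comp_add_right
      (fun s : ℝ => s⁻¹), integral_inv_of_pos (by linarith) (by linarith)]
    simp
  have hint : IntervalIntegrable (fun s => (t - s + 2 * (2 : ℝ) ^ (-(n : ℝ)))⁻¹) volume 0 t := by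
    refine ContinuousOn.intervalIntegrable (ContinuousOn.inv₀ (by fun_prop) fun s hs => ?_)
    rw [Set.uIcc_of_le ht.le] at hs
    have := hs.2
    exact (by linarith : 0 < t - s + 2 * (2 : ℝ) ^ (-(n : ℝ))).ne'
  rw [intervalIntegrable_iff_integrableOn_Ioo_of_le ht.le] at hint
  rw [← hcomp, c2, intervalIntegral.integral_of_le ht.le, intervalIntegral.integral_of_le ht.le,
    integral_Ioc_eq_integral_Ioo, integral_Ioc_eq_integral_Ioo]
  refine mul_le_mul_of_nonneg_left (integral_mono_of_nonneg ?_ hint ?_) two_pos.le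
  · filter_upwards [ae_restrict_mem measurableSet_Ioo] with s hs
    exact integral_nonneg fun w =>
      mul_nonneg (mehlerK_nonneg (sub_nonneg.2 hs.2.le) x w) (sq_nonneg _)
  · filter_upwards [ae_restrict_mem measurableSet_Ioo] with s hs
    exact integral_mehlerK_mul_covC_sq_le n hs.1.le hs.2 x

lemma c2_le (n : ℕ) {t : ℝ} (ht : 0 < t) (x : EuclideanSpace ℝ (Fin 3)) :
    c2 n t x ≤ 8 * (t + 2) ^ ((1 : ℝ) / 4) * (2 : ℝ) ^ ((n : ℝ) / 4) := by
  have he : (0 : ℝ) < 2 ^ (-(n : ℝ)) := by positivity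
  have he1 : (2 : ℝ) ^ (-(n : ℝ)) ≤ 1 :=
    Real.rpow_le_one_of_one_le_of_nonpos one_le_two (by simp)
  have hn : (2 : ℝ) ^ (-(n : ℝ)) * 2 ^ (n : ℝ) = 1 := by
    rw [← Real.rpow_add two_pos]
    simp
  have hle : (t + 2 * (2 : ℝ) ^ (-(n : ℝ))) / (2 * (2 : ℝ) ^ (-(n : ℝ))) ≤
      (t + 2) * 2 ^ (n : ℝ) := by
    rw [div_le_iff₀ (by positivity)]
    linear_combination he1 * 2 + ht - 2 * (t + 2) * hn
  have hlog := Real.log_le_rpow_div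
    (by positivity : 0 ≤ (t + 2 * (2 : ℝ) ^ (-(n : ℝ))) / (2 * (2 : ℝ) ^ (-(n : ℝ))))
    (by norm_num : (0 : ℝ) < 1 / 4)
  have hr := Real.rpow_le_rpow (by positivity) hle (by norm_num : (0 : ℝ) ≤ 1 / 4)
  rw [Real.mul_rpow (by positivity) (by positivity), ← Real.rpow_mul two_pos.le,
    mul_one_div] at hr
  have := c2_le_log n ht x
  linarith

lemma c1_eq (n : ℕ) (t : ℝ) (x : EuclideanSpace ℝ (Fin 3)) :
    c1 n t x = (1 / 2) * ∫ σ in (2 * (2 : ℝ) ^ (-(n : ℝ)))..(2 * (t + (2 : ℝ) ^ (-(n : ℝ)))),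
      mehlerK σ x x := by
  rw [c1, intervalIntegral.integral_comp_mul_left (fun σ => mehlerK σ x x) two_ne_zero]
  simp

lemma two_rpow_neg_rpow (n : ℕ) :
    ((2 : ℝ) ^ (-(n : ℝ))) ^ (-(1 : ℝ) / 2) = 2 ^ ((n : ℝ) / 2) := by
  rw [← Real.rpow_mul two_pos.le]
  ring_nf

lemma c1_le (n : ℕ) {t : ℝ} (ht : 0 ≤ t) (x : EuclideanSpace ℝ (Fin 3)) :
    c1 n t x ≤ (2 : ℝ) ^ ((n : ℝ) / 2) := by
  have he : (0 : ℝ) < 2 ^ (-(n : ℝ)) := by positivity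
  have h := integral_mehlerK_le x x (by linarith : 0 < 2 * (2 : ℝ) ^ (-(n : ℝ)))
    (by linarith : _ ≤ 2 * (t + (2 : ℝ) ^ (-(n : ℝ))))
  have h2 : (2 * (2 : ℝ) ^ (-(n : ℝ))) ^ (-(1 : ℝ) / 2) ≤ ((2 : ℝ) ^ (-(n : ℝ))) ^ (-(1 : ℝ) / 2) :=
    Real.rpow_le_rpow_of_nonpos he (by linarith) (by norm_num)
  rw [two_rpow_neg_rpow] at h2
  rw [c1_eq]
  linarith

lemma sinh_le_two_mul {u : ℝ} (hu : 0 ≤ u) (hu1 : u ≤ 1) : Real.sinh u ≤ 2 * u := by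
  have h1 := (le_abs_self _).trans (Real.abs_exp_sub_one_le (x := u) (by rwa [abs_of_nonneg hu]))
  have h2 := (neg_abs_le _).trans' (neg_le_neg
    (Real.abs_exp_sub_one_le (x := -u) (by rwa [abs_neg, abs_of_nonneg hu])))
  rw [abs_of_nonneg hu] at h1
  rw [abs_neg, abs_of_nonneg hu] at h2
  rw [Real.sinh_eq]
  linarith

lemma le_mehlerK_self {σ : ℝ} (hσ : 0 < σ) (hσ1 : σ ≤ 1 / 2) (x : EuclideanSpace ℝ (Fin 3)) :
    Real.exp (-‖x‖ ^ 2) * (8 * π * σ) ^ (-(3 : ℝ) / 2) ≤ mehlerK σ x x := by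
  have hs : 0 < Real.sinh (2 * σ) := Real.sinh_pos_iff.2 (by linarith)
  have h1 := sinh_le_two_mul (by linarith : 0 ≤ 2 * σ) (by linarith)
  rw [mehlerK, mul_comm]
  refine mul_le_mul (Real.rpow_le_rpow_of_nonpos (by positivity) ?_ (by norm_num))
    (Real.exp_le_exp.2 ?_) (Real.exp_pos _).le (by positivity)
  · nlinarith [Real.pi_pos]
  · rw [← two_smul ℝ x, norm_smul]
    have := Real.tanh_lt_one σ
    simp only [sub_self, norm_zero, Real.norm_ofNat, ne_eq, OfNat.ofNat_ne_zero,
      not_false_eq_true, zero_pow, neg_zero, zero_div, zero_sub]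
    nlinarith [sq_nonneg ‖x‖]

lemma le_c1 (x : EuclideanSpace ℝ (Fin 3)) :
    ∃ A : ℝ, 0 < A ∧ ∀ (n : ℕ) (t : ℝ), (2 : ℝ) ^ (-(n : ℝ)) ≤ t → (2 : ℝ) ^ (-(n : ℝ)) ≤ 1 / 8 →
      A * (2 : ℝ) ^ ((n : ℝ) / 2) ≤ c1 n t x := by
  refine ⟨Real.exp (-‖x‖ ^ 2) * (32 * π) ^ (-(3 : ℝ) / 2), by positivity, fun n t hnt hn => ?_⟩
  have he : (0 : ℝ) < 2 ^ (-(n : ℝ)) := by positivity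
  rw [c1_eq, ← two_rpow_neg_rpow]
  set e : ℝ := 2 ^ (-(n : ℝ))
  have hmono : ∫ σ in (2 * e)..(4 * e), mehlerK σ x x ≤
      ∫ σ in (2 * e)..(2 * (t + e)), mehlerK σ x x := by
    refine intervalIntegral.integral_mono_interval le_rfl (by linarith) (by linarith) ?_
      (intervalIntegrable_mehlerK x x (by linarith) (by linarith))
    filter_upwards [ae_restrict_mem measurableSet_Ioc] with σ hσ
    exact mehlerK_nonneg (by linarith [hσ.1]) x x
  have hconst : ∫ σ in (2 * e)..(4 * e), Real.exp (-‖x‖ ^ 2) * (32 * π * e) ^ (-(3 : ℝ) / 2) ≤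
      ∫ σ in (2 * e)..(4 * e), mehlerK σ x x := by
    refine intervalIntegral.integral_mono_on (by linarith) intervalIntegrable_const
      (intervalIntegrable_mehlerK x x (by linarith) (by linarith)) fun σ hσ => ?_
    have hσ0 : 0 < σ := by linarith [hσ.1]
    refine le_trans ?_ (le_mehlerK_self hσ0 (by linarith [hσ.2]) x)
    refine mul_le_mul_of_nonneg_left
      (Real.rpow_le_rpow_of_nonpos (by positivity) ?_ (by norm_num)) (Real.exp_pos _).le
    nlinarith [Real.pi_pos, hσ.2]
  rw [intervalIntegral.integral_const, smul_eq_mul, Real.mul_rpow (by positivity) he.le] at hconst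
  have hpow : e ^ (-(1 : ℝ) / 2) = e * e ^ (-(3 : ℝ) / 2) := by
    rw [← Real.rpow_one_add' he.le (by norm_num)]
    norm_num
  rw [hpow]
  linarith

/-- for fixed `t > 0` and `x`, the renormalization function `c_n(t,x)` grows
like `2^{n/2}` for large `n`. -/
theorem cRen_growth (t : ℝ) (ht : 0 < t) (x : EuclideanSpace ℝ (Fin 3)) :
    ∃ c₁ c₂ : ℝ, 0 < c₁ ∧ 0 < c₂ ∧ ∃ N : ℕ, 1 ≤ N ∧
      ∀ n : ℕ, N ≤ n →
        c₁ * (2 : ℝ) ^ ((n : ℝ) / 2) ≤ cRen n t x ∧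
          cRen n t x ≤ c₂ * (2 : ℝ) ^ ((n : ℝ) / 2) := by
  obtain ⟨A, hA, hlow⟩ := le_c1 x
  set B : ℝ := 8 * (t + 2) ^ ((1 : ℝ) / 4)
  have hzero : Filter.Tendsto (fun n : ℕ => (2 : ℝ) ^ (-(n : ℝ))) Filter.atTop (nhds 0) := by
    simpa [Real.rpow_neg, ← inv_pow] using
      tendsto_pow_atTop_nhds_zero_of_lt_one (by norm_num : (0 : ℝ) ≤ 2⁻¹) (by norm_num)
  have htop : Filter.Tendsto (fun n : ℕ => (2 : ℝ) ^ ((n : ℝ) / 4)) Filter.atTop Filter.atTop :=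
    (tendsto_rpow_atTop_of_base_gt_one 2 one_lt_two).comp
      (tendsto_natCast_atTop_atTop.atTop_div_const four_pos)
  obtain ⟨N, hN⟩ := Filter.eventually_atTop.1 ((Filter.eventually_ge_atTop 1).and
    ((hzero.eventually_le_const ht).and ((hzero.eventually_le_const
      (by norm_num : (0 : ℝ) < 1 / 8)).and (htop.eventually_ge_atTop (9 * B / (2 * A))))))
  refine ⟨A, 3, hA, three_pos, N, (hN N le_rfl).1, fun n hn => ?_⟩
  obtain ⟨-, h1, h2, h3⟩ := hN n hn
  have hl := hlow n t h1 h2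
  have hu := c1_le n ht.le x
  have h0 := c2_nonneg n ht.le x
  have hc := c2_le n ht x
  unfold cRen
  refine ⟨?_, by linarith⟩
  have hsq : (2 : ℝ) ^ ((n : ℝ) / 2) = 2 ^ ((n : ℝ) / 4) * 2 ^ ((n : ℝ) / 4) := by
    rw [← Real.rpow_add two_pos]
    ring_nf
  have hX : (0 : ℝ) < 2 ^ ((n : ℝ) / 4) := by positivity
  rw [div_le_iff₀ (by positivity)] at h3
  have h4 := mul_le_mul_of_nonneg_right h3 hX.le
  rw [hsq] at hl ⊢
  linarith

end
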